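/- arXiv:2312.02667 — 2 statements merged into one kernel-verified Lean document; each statement's English description precedes it below -/
import Mathlib

section
/- Let the MPS be in canonical form with normalized wavefunction Σ_σ |Ψ(σ)|² = 1, and let χ' ≥ 1 be a truncation rank with 2 ε(χ') < 1 (so that Ψ̃_T ≠ 0). Let Ψ_T = Ψ̃_T / ‖Ψ̃_T‖. Then the wavefunction fidelity satisfies the looser bound 𝓕₂ = |⟨Ψ, Ψ_T⟩|² ≥ 1 − 2 Σ_{i=1}^{N−1} √(ε_i(χ')). -/
open Matrix

/-- Partial product `Λ⁰ Γ¹ Λ¹ ⋯ Γⁱ Λⁱ` of an MPS; the tensor `Γ i` is the site tensor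
of site `i + 1` (sites are numbered `1, …, N`, bonds `0, 1, …, N`). -/
noncomputable def mpsW {d : ℕ} (χ : ℕ → ℕ)
    (Γ : (i : ℕ) → Fin d → Matrix (Fin (χ i)) (Fin (χ (i + 1))) ℂ)
    (Λ : (i : ℕ) → Matrix (Fin (χ i)) (Fin (χ i)) ℂ) :
    (i : ℕ) → (ℕ → Fin d) → Matrix (Fin (χ 0)) (Fin (χ i)) ℂ
  | 0, _ => Λ 0
  | (i + 1), σ => mpsW χ Γ Λ i σ * Γ i (σ i) * Λ (i + 1)

/-- The MPS wavefunction `Ψ(σ)`: the unique entry (written as the sum of all entries) of the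
`1 × 1` matrix `Λ⁰ Γ¹ Λ¹ Γ² Λ² ⋯ Γᴺ Λᴺ` (the bond dimensions satisfy `χ 0 = χ N = 1`). -/
noncomputable def mpsPsi {d : ℕ} [NeZero d] (N : ℕ) (χ : ℕ → ℕ)
    (Γ : (i : ℕ) → Fin d → Matrix (Fin (χ i)) (Fin (χ (i + 1))) ℂ)
    (Λ : (i : ℕ) → Matrix (Fin (χ i)) (Fin (χ i)) ℂ)
    (σ : Fin N → Fin d) : ℂ :=
  ∑ a, ∑ b, mpsW χ Γ Λ N (fun k => if h : k < N then σ ⟨k, h⟩ else 0) a b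

/-- The diagonal projector `P` onto the first `χ'` basis vectors. -/
noncomputable def truncP (χ' k : ℕ) : Matrix (Fin k) (Fin k) ℂ :=
  Matrix.diagonal fun α => if (α : ℕ) < χ' then 1 else 0

/-- Partial product of the truncated MPS, with the projector `P` inserted at every
interior bond `i = 1, …, N - 1`. -/
noncomputable def mpsWT {d : ℕ} (N χ' : ℕ) (χ : ℕ → ℕ)
    (Γ : (i : ℕ) → Fin d → Matrix (Fin (χ i)) (Fin (χ (i + 1))) ℂ)
    (Λ : (i : ℕ) → Matrix (Fin (χ i)) (Fin (χ i)) ℂ) :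
    (i : ℕ) → (ℕ → Fin d) → Matrix (Fin (χ 0)) (Fin (χ i)) ℂ
  | 0, _ => Λ 0
  | (i + 1), σ => mpsWT N χ' χ Γ Λ i σ * Γ i (σ i) * Λ (i + 1) *
      (if i + 1 < N then truncP χ' (χ (i + 1)) else 1)

/-- The truncated wavefunction `Ψ̃_T(σ)`: the unique entry of
`Λ⁰ Γ¹ Λ¹ P₁ Γ² Λ² P₂ ⋯ P_{N-1} Γᴺ Λᴺ`. -/
noncomputable def mpsPsiT {d : ℕ} [NeZero d] (N χ' : ℕ) (χ : ℕ → ℕ)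
    (Γ : (i : ℕ) → Fin d → Matrix (Fin (χ i)) (Fin (χ (i + 1))) ℂ)
    (Λ : (i : ℕ) → Matrix (Fin (χ i)) (Fin (χ i)) ℂ)
    (σ : Fin N → Fin d) : ℂ :=
  ∑ a, ∑ b, mpsWT N χ' χ Γ Λ N (fun k => if h : k < N then σ ⟨k, h⟩ else 0) a b

/-- Canonical form: for every site `i + 1` (`i < N`), with `A = Λ i * Γ i s` and
`B = Γ i s * Λ (i+1)`, one has `∑ s, Aᴴ A = 1` and `∑ s, B Bᴴ = 1`. -/
noncomputable def IsCanonicalMPS {d : ℕ} (N : ℕ) (χ : ℕ → ℕ)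
    (Γ : (i : ℕ) → Fin d → Matrix (Fin (χ i)) (Fin (χ (i + 1))) ℂ)
    (Λ : (i : ℕ) → Matrix (Fin (χ i)) (Fin (χ i)) ℂ) : Prop :=
  ∀ i < N,
    (∑ s : Fin d, (Λ i * Γ i s)ᴴ * (Λ i * Γ i s) = 1) ∧
    (∑ s : Fin d, (Γ i s * Λ (i + 1)) * (Γ i s * Λ (i + 1))ᴴ = 1)

/-- Local truncation error `ε_i(χ') = ∑_{α ≥ χ'} (Λ^{[i]}_{αα})²`. -/
noncomputable def locErr (χ' : ℕ) (χ : ℕ → ℕ)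
    (Λ : (i : ℕ) → Matrix (Fin (χ i)) (Fin (χ i)) ℂ) (i : ℕ) : ℝ :=
  ∑ α : Fin (χ i), if χ' ≤ (α : ℕ) then ((Λ i α α).re) ^ 2 else 0

/-- Global truncation error `ε(χ') = ∑_{i=1}^{N-1} ε_i(χ')`. -/
noncomputable def globErr (N χ' : ℕ) (χ : ℕ → ℕ)
    (Λ : (i : ℕ) → Matrix (Fin (χ i)) (Fin (χ i)) ℂ) : ℝ :=
  ∑ i ∈ Finset.Ico 1 N, locErr χ' χ Λ i

/-- Squared Frobenius norm of a complex matrix. -/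
noncomputable def frobSq {m n : Type*} [Fintype m] [Fintype n] (M : Matrix m n ℂ) : ℝ :=
  ∑ a, ∑ b, ‖M a b‖ ^ 2

section FrobeniusNorm

variable {l m n ι : Type*} [Fintype l] [Fintype m] [Fintype n] [Fintype ι]

theorem ofReal_frobSq (M : Matrix m n ℂ) : (frobSq M : ℂ) = (M * Mᴴ).trace := by
  simp [frobSq, Matrix.trace, Matrix.mul_apply, Complex.mul_conj']

theorem frobSq_conjTranspose (M : Matrix m n ℂ) : frobSq Mᴴ = frobSq M := by
  unfold frobSq
  rw [Finset.sum_comm]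
  simp

theorem frobSq_eq_sq_norm_sum [Unique m] [Unique n] (M : Matrix m n ℂ) :
    frobSq M = ‖∑ a, ∑ b, M a b‖ ^ 2 := by
  simp [frobSq]

theorem sum_frobSq_mul_of_sum_mul_conjTranspose [DecidableEq m] {B : ι → Matrix m n ℂ}
    (hB : ∑ s, B s * (B s)ᴴ = 1) (M : Matrix l m ℂ) :
    ∑ s, frobSq (M * B s) = frobSq M := by
  apply Complex.ofReal_injective
  rw [Complex.ofReal_sum]
  simp only [ofReal_frobSq]
  rw [← Matrix.trace_sum]
  have h : ∀ s, M * B s * (M * B s)ᴴ = M * (B s * (B s)ᴴ) * Mᴴ := fun s => by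
    simp only [Matrix.conjTranspose_mul, Matrix.mul_assoc]
  simp only [h]
  rw [← Matrix.sum_mul, ← Matrix.mul_sum, hB, Matrix.mul_one]

theorem sum_frobSq_mul_of_sum_conjTranspose_mul [DecidableEq n] {A : ι → Matrix m n ℂ}
    (hA : ∑ s, (A s)ᴴ * A s = 1) (M : Matrix n l ℂ) :
    ∑ s, frobSq (A s * M) = frobSq M := by
  have h := sum_frobSq_mul_of_sum_mul_conjTranspose (B := fun s => (A s)ᴴ)
    (by simpa using hA) Mᴴ
  simpa only [← Matrix.conjTranspose_mul, frobSq_conjTranspose] using h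

theorem sqrt_sum_frobSq_add_le (F G : ι → Matrix m n ℂ) :
    √(∑ i, frobSq (F i + G i)) ≤ √(∑ i, frobSq (F i)) + √(∑ i, frobSq (G i)) := by
  have key : ∀ H : ι → Matrix m n ℂ, √(∑ i, frobSq (H i)) =
      ‖(WithLp.toLp 2 fun p : ι × m × n => H p.1 p.2.1 p.2.2 :
        EuclideanSpace ℂ (ι × m × n))‖ := fun H => by
    simp [EuclideanSpace.norm_eq, Fintype.sum_prod_type, frobSq]
  rw [key F, key G, key fun i => F i + G i]
  exact norm_add_le (WithLp.toLp 2 fun p : ι × m × n => F p.1 p.2.1 p.2.2 :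
    EuclideanSpace ℂ (ι × m × n)) (WithLp.toLp 2 fun p => G p.1 p.2.1 p.2.2)

theorem frobSq_mul_diagonal_mul_le [DecidableEq m] {D : Matrix m m ℂ} (hD : D.IsDiag)
    {p : m → ℂ} (hp : ∀ a, ‖p a‖ ≤ 1) (V : Matrix m n ℂ) :
    frobSq (D * (Matrix.diagonal p * V)) ≤ frobSq (D * V) := by
  rw [← hD.diagonal_diag]
  refine Finset.sum_le_sum fun a _ => Finset.sum_le_sum fun b _ => ?_
  simp only [Matrix.diagonal_mul, norm_mul]
  gcongr
  exact mul_le_of_le_one_left (norm_nonneg _) (hp a)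

end FrobeniusNorm

theorem one_sub_two_mul_le_sq_norm_inner_div {E : Type*} [NormedAddCommGroup E]
    [InnerProductSpace ℂ E] {x y : E} {S : ℝ} (hx : ‖x‖ = 1) (hy : ‖y‖ ≤ 1)
    (hxy : ‖x - y‖ ≤ S) : 1 - 2 * S ≤ (‖inner ℂ x y‖ / ‖y‖) ^ 2 := by
  by_cases hS : 1 - 2 * S ≤ 0
  · exact hS.trans (sq_nonneg _)
  have h_inner : 1 - S ≤ ‖inner ℂ x y‖ := by
    have h1 : inner ℂ x x = inner ℂ x y + inner ℂ x (x - y) := by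
      rw [inner_sub_right]; ring
    have h2 : ‖inner ℂ x x‖ = 1 := by simp [inner_self_eq_norm_sq_to_K, hx]
    have h3 := norm_add_le (inner ℂ x y) (inner ℂ x (x - y))
    have h4 := norm_inner_le_norm (𝕜 := ℂ) x (x - y)
    rw [← h1, h2] at h3
    rw [hx, one_mul] at h4
    linarith
  have hy0 : 0 < ‖y‖ := by
    have := norm_sub_norm_le x y
    linarith
  have h : 1 - S ≤ ‖inner ℂ x y‖ / ‖y‖ :=
    h_inner.trans (le_div_self (norm_nonneg _) hy0 hy)
  nlinarith [sq_nonneg S]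

section PartialProducts

variable {d : ℕ} {χ : ℕ → ℕ} {Γ : (i : ℕ) → Fin d → Matrix (Fin (χ i)) (Fin (χ (i + 1))) ℂ}
  {Λ : (i : ℕ) → Matrix (Fin (χ i)) (Fin (χ i)) ℂ}

theorem mpsW_congr {i : ℕ} {σ τ : ℕ → Fin d} (h : ∀ k < i, σ k = τ k) :
    mpsW χ Γ Λ i σ = mpsW χ Γ Λ i τ := by
  induction i with
  | zero => rfl
  | succ i ih =>
    simp only [mpsW]
    rw [ih fun k hk => h k (hk.trans i.lt_succ_self), h i i.lt_succ_self]

theorem mpsWT_congr {N χ' i : ℕ} {σ τ : ℕ → Fin d} (h : ∀ k < i, σ k = τ k) :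
    mpsWT N χ' χ Γ Λ i σ = mpsWT N χ' χ Γ Λ i τ := by
  induction i with
  | zero => rfl
  | succ i ih =>
    simp only [mpsWT]
    rw [ih fun k hk => h k (hk.trans i.lt_succ_self), h i i.lt_succ_self]

theorem sum_config_succ {n : ℕ} (G : (Fin (n + 1) → Fin d) → ℝ) :
    ∑ σ, G σ = ∑ s : Fin d, ∑ σ : Fin n → Fin d, G (Fin.snoc σ s) := by
  rw [← (Fin.snocEquiv fun _ => Fin d).sum_comp, Fintype.sum_prod_type]
  rfl

variable [NeZero d]

/-- Extension of a configuration of the first `n` sites by `0`. -/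
def padConfig (n : ℕ) (σ : Fin n → Fin d) : ℕ → Fin d :=
  fun k => if h : k < n then σ ⟨k, h⟩ else 0

theorem padConfig_snoc_of_lt {n : ℕ} (σ : Fin n → Fin d) (s : Fin d) {k : ℕ} (hk : k < n) :
    padConfig (n + 1) (Fin.snoc σ s : Fin (n + 1) → Fin d) k = padConfig n σ k := by
  simp [padConfig, hk, hk.trans n.lt_succ_self, Fin.snoc]

theorem padConfig_snoc_self {n : ℕ} (σ : Fin n → Fin d) (s : Fin d) :
    padConfig (n + 1) (Fin.snoc σ s : Fin (n + 1) → Fin d) n = s := by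
  simp [padConfig, Fin.snoc]

theorem mpsW_snoc {i : ℕ} (σ : Fin i → Fin d) (s : Fin d) :
    mpsW χ Γ Λ (i + 1) (padConfig (i + 1) (Fin.snoc σ s : Fin (i + 1) → Fin d)) =
      mpsW χ Γ Λ i (padConfig i σ) * (Γ i s * Λ (i + 1)) := by
  rw [mpsW, padConfig_snoc_self, mpsW_congr fun k hk => padConfig_snoc_of_lt σ s hk,
    Matrix.mul_assoc]

/-- The projector inserted at bond `i` of the truncated state. -/
noncomputable def bondP (N χ' : ℕ) (χ : ℕ → ℕ) (i : ℕ) : Matrix (Fin (χ i)) (Fin (χ i)) ℂ :=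
  if i < N then truncP χ' (χ i) else 1

theorem mpsWT_snoc {N χ' i : ℕ} (σ : Fin i → Fin d) (s : Fin d) :
    mpsWT N χ' χ Γ Λ (i + 1) (padConfig (i + 1) (Fin.snoc σ s : Fin (i + 1) → Fin d)) =
      mpsWT N χ' χ Γ Λ i (padConfig i σ) * (Γ i s * Λ (i + 1) * bondP N χ' χ (i + 1)) := by
  rw [mpsWT, padConfig_snoc_self, mpsWT_congr fun k hk => padConfig_snoc_of_lt σ s hk,
    bondP]
  simp only [Matrix.mul_assoc]

theorem frobSq_mul_bondP_mul_le {N χ' i n : ℕ} (hΛ : (Λ i).IsDiag)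
    (V : Matrix (Fin (χ i)) (Fin n) ℂ) :
    frobSq (Λ i * (bondP N χ' χ i * V)) ≤ frobSq (Λ i * V) := by
  unfold bondP truncP
  split_ifs
  · refine frobSq_mul_diagonal_mul_le hΛ (fun a => ?_) V
    split_ifs <;> simp
  · rw [Matrix.one_mul]

theorem frobSq_mul_one_sub_bondP {N χ' i : ℕ} (hΛ : (Λ i).IsDiag)
    (hreal : ∀ α, (Λ i α α).im = 0) :
    frobSq (Λ i * (1 - bondP N χ' χ i)) = if i < N then locErr χ' χ Λ i else 0 := by
  unfold bondP truncP
  split_ifs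
  · rw [← hΛ.diagonal_diag, ← Matrix.diagonal_one, Matrix.diagonal_sub,
      Matrix.diagonal_mul_diagonal, frobSq, locErr]
    refine Finset.sum_congr rfl fun a _ => ?_
    rw [Finset.sum_eq_single a (fun b _ hb => by simp [Matrix.diagonal_apply_ne' _ hb])
      (by simp), Matrix.diagonal_apply_eq]
    by_cases h : (a : ℕ) < χ'
    · simp [h]
    · rw [if_neg h, if_pos (not_lt.mp h), sub_zero, mul_one, Matrix.diag_apply,
        Complex.sq_norm, Complex.normSq_apply, hreal a]
      ring
  · simp [frobSq]

theorem sum_frobSq_mpsWT_mul_le {N χ' i n : ℕ} (hcano : IsCanonicalMPS N χ Γ Λ)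
    (hΛ : ∀ i ≤ N, (Λ i).IsDiag) (hi : i ≤ N) (V : Matrix (Fin (χ i)) (Fin n) ℂ) :
    ∑ σ, frobSq (mpsWT N χ' χ Γ Λ i (padConfig i σ) * V) ≤ frobSq (Λ i * V) := by
  induction i with
  | zero => simp [mpsWT]
  | succ i ih =>
    rw [sum_config_succ]
    simp only [mpsWT_snoc, Matrix.mul_assoc]
    calc _ ≤ ∑ s, frobSq (Λ i * (Γ i s * (Λ (i + 1) * (bondP N χ' χ (i + 1) * V)))) :=
          Finset.sum_le_sum fun s _ => ih (Nat.le_of_succ_le hi) _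
      _ = frobSq (Λ (i + 1) * (bondP N χ' χ (i + 1) * V)) := by
          simpa only [Matrix.mul_assoc] using
            sum_frobSq_mul_of_sum_conjTranspose_mul (hcano i hi).1
              (Λ (i + 1) * (bondP N χ' χ (i + 1) * V))
      _ ≤ _ := frobSq_mul_bondP_mul_le (hΛ _ hi) V

theorem sqrt_sum_frobSq_mpsW_sub_mpsWT_le {N χ' i : ℕ} (hcano : IsCanonicalMPS N χ Γ Λ)
    (hΛ : ∀ i ≤ N, (Λ i).IsDiag) (hreal : ∀ i ≤ N, ∀ α, (Λ i α α).im = 0) (hi : i ≤ N) :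
    √(∑ σ, frobSq (mpsW χ Γ Λ i (padConfig i σ) - mpsWT N χ' χ Γ Λ i (padConfig i σ))) ≤
      ∑ k ∈ Finset.range i, √(if k + 1 < N then locErr χ' χ Λ (k + 1) else 0) := by
  induction i with
  | zero => simp [mpsW, mpsWT, frobSq]
  | succ i ih =>
    have hstep : ∀ (s : Fin d) (σ : Fin i → Fin d),
        mpsW χ Γ Λ (i + 1) (padConfig (i + 1) (Fin.snoc σ s : Fin (i + 1) → Fin d)) -
          mpsWT N χ' χ Γ Λ (i + 1) (padConfig (i + 1) (Fin.snoc σ s : Fin (i + 1) → Fin d)) =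
        (mpsW χ Γ Λ i (padConfig i σ) - mpsWT N χ' χ Γ Λ i (padConfig i σ)) *
            (Γ i s * Λ (i + 1)) +
          mpsWT N χ' χ Γ Λ i (padConfig i σ) *
            (Γ i s * (Λ (i + 1) * (1 - bondP N χ' χ (i + 1)))) := fun s σ => by
      rw [mpsW_snoc, mpsWT_snoc]
      simp only [Matrix.mul_sub, Matrix.sub_mul, Matrix.mul_one, Matrix.mul_assoc]
      abel
    have hadd := sqrt_sum_frobSq_add_le (ι := Fin d × (Fin i → Fin d))
      (fun p => (mpsW χ Γ Λ i (padConfig i p.2) - mpsWT N χ' χ Γ Λ i (padConfig i p.2)) *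
        (Γ i p.1 * Λ (i + 1)))
      (fun p => mpsWT N χ' χ Γ Λ i (padConfig i p.2) *
        (Γ i p.1 * (Λ (i + 1) * (1 - bondP N χ' χ (i + 1)))))
    simp only [Fintype.sum_prod_type] at hadd
    have hold : ∑ s, ∑ σ, frobSq ((mpsW χ Γ Λ i (padConfig i σ) -
        mpsWT N χ' χ Γ Λ i (padConfig i σ)) * (Γ i s * Λ (i + 1))) =
        ∑ σ, frobSq (mpsW χ Γ Λ i (padConfig i σ) - mpsWT N χ' χ Γ Λ i (padConfig i σ)) := by
      rw [Finset.sum_comm]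
      exact Finset.sum_congr rfl fun σ _ =>
        sum_frobSq_mul_of_sum_mul_conjTranspose (B := fun s => Γ i s * Λ (i + 1))
          (hcano i hi).2 _
    have hnew : ∑ s, ∑ σ, frobSq (mpsWT N χ' χ Γ Λ i (padConfig i σ) *
        (Γ i s * (Λ (i + 1) * (1 - bondP N χ' χ (i + 1))))) ≤
        if i + 1 < N then locErr χ' χ Λ (i + 1) else 0 := by
      rw [← frobSq_mul_one_sub_bondP (hΛ _ hi) (hreal _ hi)]
      calc _ ≤ ∑ s, frobSq (Λ i * (Γ i s * (Λ (i + 1) * (1 - bondP N χ' χ (i + 1))))) :=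
            Finset.sum_le_sum fun s _ =>
              sum_frobSq_mpsWT_mul_le hcano hΛ (Nat.le_of_succ_le hi) _
        _ = _ := by
            simpa only [Matrix.mul_assoc] using
              sum_frobSq_mul_of_sum_conjTranspose_mul (hcano i hi).1
                (Λ (i + 1) * (1 - bondP N χ' χ (i + 1)))
    rw [sum_config_succ, Finset.sum_range_succ]
    simp only [hstep]
    rw [hold] at hadd
    exact hadd.trans (add_le_add (ih (Nat.le_of_succ_le hi)) (Real.sqrt_le_sqrt hnew))

end PartialProducts

/-- looser fidelity bound, Eq. (16) of the paper: for an `N`-site MPS in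
canonical form with normalized wavefunction and a truncation rank `χ'` with `2 ε(χ') < 1`,
the fidelity of the renormalized truncated state `Ψ_T = Ψ̃_T / ‖Ψ̃_T‖` with `Ψ` satisfies
`𝓕₂ = |⟨Ψ, Ψ_T⟩|² ≥ 1 − 2 ∑_{i=1}^{N−1} √(ε_i(χ'))`. -/
theorem parallel_mps_compression_fidelity_bound_looser
    (N d : ℕ) [NeZero d] (hN : 1 ≤ N)
    (χ : ℕ → ℕ) (hχ0 : χ 0 = 1) (hχN : χ N = 1) (hχpos : ∀ i, 1 ≤ χ i)
    (Γ : (i : ℕ) → Fin d → Matrix (Fin (χ i)) (Fin (χ (i + 1))) ℂ)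
    (Λ : (i : ℕ) → Matrix (Fin (χ i)) (Fin (χ i)) ℂ)
    (hΛ0 : Λ 0 = 1) (hΛN : Λ N = 1)
    (hΛdiag : ∀ i ≤ N, (Λ i).IsDiag)
    (hΛreal : ∀ i ≤ N, ∀ α, (Λ i α α).im = 0 ∧ 0 ≤ (Λ i α α).re)
    (hΛdesc : ∀ i ≤ N, ∀ α β : Fin (χ i), α ≤ β → (Λ i β β).re ≤ (Λ i α α).re)
    (hcano : IsCanonicalMPS N χ Γ Λ)
    (hnorm : ∑ σ : Fin N → Fin d, ‖mpsPsi N χ Γ Λ σ‖ ^ 2 = 1)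
    (χ' : ℕ) (hχ' : 1 ≤ χ')
    (hsmall : 2 * globErr N χ' χ Λ < 1) :
    1 - 2 * ∑ i ∈ Finset.Ico 1 N, Real.sqrt (locErr χ' χ Λ i) ≤
      ‖∑ σ : Fin N → Fin d, (starRingEnd ℂ) (mpsPsi N χ Γ Λ σ) *
        (mpsPsiT N χ' χ Γ Λ σ /
          (Real.sqrt (∑ τ : Fin N → Fin d, ‖mpsPsiT N χ' χ Γ Λ τ‖ ^ 2) : ℂ))‖ ^ 2 := by
  let x : EuclideanSpace ℂ (Fin N → Fin d) := WithLp.toLp 2 (mpsPsi N χ Γ Λ)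
  let y : EuclideanSpace ℂ (Fin N → Fin d) := WithLp.toLp 2 (mpsPsiT N χ' χ Γ Λ)
  have : Unique (Fin (χ 0)) := by rw [hχ0]; infer_instance
  have : Unique (Fin (χ N)) := by rw [hχN]; infer_instance
  have hx : ‖x‖ = 1 := by
    rw [EuclideanSpace.norm_eq, Real.sqrt_eq_one]
    exact hnorm
  have hy : ‖y‖ ≤ 1 := by
    rw [EuclideanSpace.norm_eq, ← Real.sqrt_one]
    apply Real.sqrt_le_sqrt
    have h := sum_frobSq_mpsWT_mul_le (χ' := χ') hcano hΛdiag le_rfl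
      (1 : Matrix (Fin (χ N)) (Fin (χ N)) ℂ)
    simp only [hΛN, Matrix.mul_one, frobSq_eq_sq_norm_sum] at h
    exact h.trans (by simp)
  have hxy : ‖x - y‖ ≤ ∑ i ∈ Finset.Ico 1 N, √(locErr χ' χ Λ i) := by
    have h := sqrt_sum_frobSq_mpsW_sub_mpsWT_le (χ' := χ') hcano hΛdiag
      (fun i hi α => (hΛreal i hi α).1) le_rfl
    have hsum : ∑ k ∈ Finset.range N, √(if k + 1 < N then locErr χ' χ Λ (k + 1) else 0) =
        ∑ i ∈ Finset.Ico 1 N, √(locErr χ' χ Λ i) := by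
      obtain ⟨n, rfl⟩ := Nat.exists_eq_add_of_le' hN
      rw [Finset.sum_range_succ, Finset.sum_Ico_eq_sum_range]
      simp only [lt_irrefl, if_false, Real.sqrt_zero, add_zero, Nat.add_sub_cancel]
      refine Finset.sum_congr rfl fun k hk => ?_
      rw [if_pos (Nat.succ_lt_succ (Finset.mem_range.mp hk)), Nat.add_comm]
    rw [hsum] at h
    refine le_trans (le_of_eq ?_) h
    rw [EuclideanSpace.norm_eq]
    congr 1
    refine Finset.sum_congr rfl fun σ _ => ?_
    rw [frobSq_eq_sq_norm_sum]
    simp only [Matrix.sub_apply, Finset.sum_sub_distrib]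
    rfl
  have hfid := one_sub_two_mul_le_sq_norm_inner_div hx hy hxy
  have hinner : inner ℂ x y = ∑ σ, (starRingEnd ℂ) (mpsPsi N χ Γ Λ σ) * mpsPsiT N χ' χ Γ Λ σ := by
    simp [x, y, PiLp.inner_apply, mul_comm]
  have hnorm_y : ‖y‖ = √(∑ τ, ‖mpsPsiT N χ' χ Γ Λ τ‖ ^ 2) := EuclideanSpace.norm_eq y
  simp only [← mul_div_assoc, ← Finset.sum_div]
  rw [← hinner, ← hnorm_y, norm_div, Complex.norm_real, norm_norm]
  exact hfid
end

section
/- Let the MPS be in canonical form with normalized wavefunction Σ_σ |Ψ(σ)|² = 1, and let χ' ≥ 1 be a truncation rank. Then the norm n = ‖Ψ̃_T‖ = (Σ_σ |Ψ̃_T(σ)|²)^{1/2} of the wavefunction after the parallel MPS compression is bounded as 1 − √(2 ε(χ')) ≤ n ≤ 1. -/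
open Matrix

/-- The ordered product `M⁰ M¹ ⋯ Mⁱ⁻¹` of site matrices selected by the configuration `σ`. -/
noncomputable def mpsChain {d : ℕ} {χ : ℕ → ℕ}
    (M : (i : ℕ) → Fin d → Matrix (Fin (χ i)) (Fin (χ (i + 1))) ℂ) :
    (i : ℕ) → (ℕ → Fin d) → Matrix (Fin (χ 0)) (Fin (χ i)) ℂ
  | 0, _ => 1
  | (i + 1), σ => mpsChain M i σ * M i (σ i)

/-- The overlap matrix of two chains, contracted site by site from the left. -/
noncomputable def mpsGram {d : ℕ} {χ : ℕ → ℕ}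
    (M M' : (i : ℕ) → Fin d → Matrix (Fin (χ i)) (Fin (χ (i + 1))) ℂ) :
    (i : ℕ) → Matrix (Fin (χ i)) (Fin (χ i)) ℂ
  | 0 => 1
  | (i + 1) => ∑ s, (M i s)ᴴ * mpsGram M M' i * M' i s

section Gram

open scoped ComplexOrder

variable {d : ℕ} {χ : ℕ → ℕ}
  (M M' : (i : ℕ) → Fin d → Matrix (Fin (χ i)) (Fin (χ (i + 1))) ℂ)

theorem mpsChain_congr {n : ℕ} {σ τ : ℕ → Fin d} (h : ∀ k < n, σ k = τ k) :
    mpsChain M n σ = mpsChain M n τ := by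
  induction n with
  | zero => rfl
  | succ n ih =>
    simp only [mpsChain]
    rw [ih fun k hk => h k (hk.trans n.lt_succ_self), h n n.lt_succ_self]

theorem sum_conjTranspose_mpsChain_mul [NeZero d] (n : ℕ) :
    ∑ σ : Fin n → Fin d,
      (mpsChain M n (fun k => if h : k < n then σ ⟨k, h⟩ else 0))ᴴ *
        mpsChain M' n (fun k => if h : k < n then σ ⟨k, h⟩ else 0) = mpsGram M M' n := by
  induction n with
  | zero => simp [mpsChain, mpsGram]
  | succ n ih =>
    rw [← (Fin.snocEquiv fun _ : Fin (n + 1) => Fin d).sum_comp, Fintype.sum_prod_type]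
    simp only [mpsGram]
    refine Finset.sum_congr rfl fun s _ => ?_
    rw [← ih, Matrix.mul_sum, Matrix.sum_mul]
    refine Finset.sum_congr rfl fun σ _ => ?_
    have key : ∀ M : (i : ℕ) → Fin d → Matrix (Fin (χ i)) (Fin (χ (i + 1))) ℂ,
        mpsChain M (n + 1) (fun k => if h : k < n + 1 then
          Fin.snocEquiv (fun _ : Fin (n + 1) => Fin d) (s, σ) ⟨k, h⟩ else 0) =
        mpsChain M n (fun k => if h : k < n then σ ⟨k, h⟩ else 0) * M n s := by
      intro M
      simp only [mpsChain]
      congr 1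
      · refine mpsChain_congr M fun k hk => ?_
        simp [hk, hk.trans n.lt_succ_self, Fin.snoc]
      · simp [Fin.snoc]
    rw [key, key, conjTranspose_mul]
    simp only [Matrix.mul_assoc]

theorem conjTranspose_mpsGram (n : ℕ) : (mpsGram M M' n)ᴴ = mpsGram M' M n := by
  induction n with
  | zero => simp [mpsGram]
  | succ n ih =>
    simp [mpsGram, conjTranspose_sum, conjTranspose_mul, ih, Matrix.mul_assoc]

theorem posSemidef_mpsGram_sub [NeZero d] (n : ℕ) :
    (mpsGram M M n + mpsGram M' M' n - mpsGram M M' n - mpsGram M' M n).PosSemidef := by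
  simp only [← sum_conjTranspose_mpsChain_mul, ← Finset.sum_add_distrib,
    ← Finset.sum_sub_distrib]
  refine posSemidef_sum _ fun σ _ => ?_
  convert posSemidef_conjTranspose_mul_self
    (mpsChain M n (fun k => if h : k < n then σ ⟨k, h⟩ else 0) -
      mpsChain M' n (fun k => if h : k < n then σ ⟨k, h⟩ else 0)) using 1
  rw [conjTranspose_sub, Matrix.sub_mul, Matrix.mul_sub, Matrix.mul_sub]
  abel

theorem sum_star_mul_eq_trace_mpsGram [NeZero d] {n : ℕ} (h0 : χ 0 = 1) (hn : χ n = 1) :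
    ∑ σ : Fin n → Fin d,
      star (∑ a, ∑ b, mpsChain M n (fun k => if h : k < n then σ ⟨k, h⟩ else 0) a b) *
        (∑ a, ∑ b, mpsChain M' n (fun k => if h : k < n then σ ⟨k, h⟩ else 0) a b) =
      (mpsGram M M' n).trace := by
  have : Unique (Fin (χ 0)) := (finCongr h0).unique
  have : Unique (Fin (χ n)) := (finCongr hn).unique
  rw [← sum_conjTranspose_mpsChain_mul, trace_sum]
  refine Finset.sum_congr rfl fun σ _ => ?_
  simp [Matrix.trace, Matrix.mul_apply]

end Gram

section Truncation

open scoped ComplexOrder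

variable {d N : ℕ} {χ : ℕ → ℕ}
  {Γ : (i : ℕ) → Fin d → Matrix (Fin (χ i)) (Fin (χ (i + 1))) ℂ}
  {Λ : (i : ℕ) → Matrix (Fin (χ i)) (Fin (χ i)) ℂ}

theorem mpsW_eq_mpsChain (hΛ0 : Λ 0 = 1) (n : ℕ) (σ : ℕ → Fin d) :
    mpsW χ Γ Λ n σ = mpsChain (fun i s => Γ i s * Λ (i + 1)) n σ := by
  induction n with
  | zero => simp [mpsW, mpsChain, hΛ0]
  | succ n ih => simp [mpsW, mpsChain, ih, Matrix.mul_assoc]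

theorem mpsWT_eq_mpsChain (hΛ0 : Λ 0 = 1) (χ' n : ℕ) (σ : ℕ → Fin d) :
    mpsWT N χ' χ Γ Λ n σ = mpsChain (fun i s => Γ i s * Λ (i + 1) *
      (if i + 1 < N then truncP χ' (χ (i + 1)) else 1)) n σ := by
  induction n with
  | zero => simp [mpsWT, mpsChain, hΛ0]
  | succ n ih => simp [mpsWT, mpsChain, ih, Matrix.mul_assoc]

theorem IsCanonicalMPS.sum_conjTranspose_mul (hcano : IsCanonicalMPS N χ Γ Λ) {k : ℕ}
    (hk : k < N) :
    ∑ s, (Γ k s * Λ (k + 1))ᴴ * ((Λ k)ᴴ * Λ k) * (Γ k s * Λ (k + 1)) =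
      (Λ (k + 1))ᴴ * Λ (k + 1) := by
  calc _ = (Λ (k + 1))ᴴ * (∑ s, (Λ k * Γ k s)ᴴ * (Λ k * Γ k s)) * Λ (k + 1) := by
        simp only [Matrix.mul_sum, Matrix.sum_mul, conjTranspose_mul, Matrix.mul_assoc]
    _ = _ := by rw [(hcano k hk).1, Matrix.mul_one]

theorem IsCanonicalMPS.trace_sum_conjTranspose_mul (hcano : IsCanonicalMPS N χ Γ Λ) {k : ℕ}
    (hk : k < N) (G : Matrix (Fin (χ k)) (Fin (χ k)) ℂ) :
    (∑ s, (Γ k s * Λ (k + 1))ᴴ * G * (Γ k s * Λ (k + 1))).trace = G.trace := by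
  calc _ = (G * ∑ s, (Γ k s * Λ (k + 1)) * (Γ k s * Λ (k + 1))ᴴ).trace := by
        rw [Matrix.mul_sum, trace_sum, trace_sum]
        refine Finset.sum_congr rfl fun s _ => ?_
        rw [Matrix.mul_assoc, trace_mul_comm, Matrix.mul_assoc]
    _ = _ := by rw [(hcano k hk).2, Matrix.mul_one]

theorem IsCanonicalMPS.mpsGram_eq (hcano : IsCanonicalMPS N χ Γ Λ) (hΛ0 : Λ 0 = 1) {k : ℕ}
    (hk : k ≤ N) :
    mpsGram (fun i s => Γ i s * Λ (i + 1)) (fun i s => Γ i s * Λ (i + 1)) k =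
      (Λ k)ᴴ * Λ k := by
  induction k with
  | zero => simp [mpsGram, hΛ0]
  | succ k ih =>
    simp only [mpsGram]
    rw [ih (Nat.le_of_succ_le hk), hcano.sum_conjTranspose_mul hk]

theorem posSemidef_sub_truncP_mul_mul {m : ℕ} (χ' : ℕ) {L : Matrix (Fin m) (Fin m) ℂ}
    (hL : L.IsDiag) :
    (Lᴴ * L - (truncP χ' m)ᴴ * (Lᴴ * L) * truncP χ' m).PosSemidef := by
  obtain ⟨v, rfl⟩ : ∃ v, diagonal v = L := ⟨_, hL.diagonal_diag⟩
  simp only [truncP, diagonal_conjTranspose, diagonal_mul_diagonal, diagonal_sub]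
  refine PosSemidef.diagonal fun α => ?_
  by_cases h : (α : ℕ) < χ'
  · simp [h]
  · simpa [h] using star_mul_self_nonneg (v α)

theorem IsCanonicalMPS.posSemidef_sub_mpsGram (hcano : IsCanonicalMPS N χ Γ Λ)
    (hΛ0 : Λ 0 = 1) (hΛdiag : ∀ i ≤ N, (Λ i).IsDiag) (χ' : ℕ) {k : ℕ} (hk : k ≤ N) :
    ((Λ k)ᴴ * Λ k - mpsGram
      (fun i s => Γ i s * Λ (i + 1) * (if i + 1 < N then truncP χ' (χ (i + 1)) else 1))
      (fun i s => Γ i s * Λ (i + 1) * (if i + 1 < N then truncP χ' (χ (i + 1)) else 1))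
      k).PosSemidef := by
  induction k with
  | zero => simpa [mpsGram, hΛ0] using PosSemidef.zero
  | succ k ih =>
    simp only [mpsGram]
    specialize ih (Nat.le_of_succ_le hk)
    set G := mpsGram
      (fun i s => Γ i s * Λ (i + 1) * (if i + 1 < N then truncP χ' (χ (i + 1)) else 1))
      (fun i s => Γ i s * Λ (i + 1) * (if i + 1 < N then truncP χ' (χ (i + 1)) else 1)) k
    set Q : Matrix (Fin (χ (k + 1))) (Fin (χ (k + 1))) ℂ :=
      if k + 1 < N then truncP χ' (χ (k + 1)) else 1 with hQ
    have h1 : ((Λ (k + 1))ᴴ * Λ (k + 1) - Qᴴ * ((Λ (k + 1))ᴴ * Λ (k + 1)) * Q).PosSemidef := by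
      rw [hQ]
      split_ifs
      · exact posSemidef_sub_truncP_mul_mul χ' (hΛdiag _ hk)
      · simpa using PosSemidef.zero
    have h2 : (∑ s, (Γ k s * Λ (k + 1) * Q)ᴴ * ((Λ k)ᴴ * Λ k - G) *
        (Γ k s * Λ (k + 1) * Q)).PosSemidef :=
      posSemidef_sum _ fun s _ => ih.conjTranspose_mul_mul_same _
    have h3 : ∑ s, (Γ k s * Λ (k + 1) * Q)ᴴ * ((Λ k)ᴴ * Λ k) * (Γ k s * Λ (k + 1) * Q) =
        Qᴴ * ((Λ (k + 1))ᴴ * Λ (k + 1)) * Q := by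
      rw [← hcano.sum_conjTranspose_mul hk, Matrix.mul_sum, Matrix.sum_mul]
      simp only [conjTranspose_mul, Matrix.mul_assoc]
    convert h1.add h2 using 1
    simp only [Matrix.mul_sub, Matrix.sub_mul, Finset.sum_sub_distrib, h3]
    abel

theorem IsCanonicalMPS.re_sum_conjTranspose_mul_mpsGram_le [NeZero d]
    (hcano : IsCanonicalMPS N χ Γ Λ)
    (hΛ0 : Λ 0 = 1) (hΛdiag : ∀ i ≤ N, (Λ i).IsDiag) (χ' : ℕ) {k : ℕ} (hk : k < N)
    (α : Fin (χ (k + 1))) :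
    ((∑ s, (Γ k s * Λ (k + 1))ᴴ * mpsGram (fun i s => Γ i s * Λ (i + 1))
      (fun i s => Γ i s * Λ (i + 1) * (if i + 1 < N then truncP χ' (χ (i + 1)) else 1)) k *
        (Γ k s * Λ (k + 1))) α α).re ≤ (((Λ (k + 1))ᴴ * Λ (k + 1)) α α).re := by
  have hpos := posSemidef_mpsGram_sub (fun i s => Γ i s * Λ (i + 1))
    (fun i s => Γ i s * Λ (i + 1) * (if i + 1 < N then truncP χ' (χ (i + 1)) else 1)) k
  have hle := hcano.posSemidef_sub_mpsGram hΛ0 hΛdiag χ' hk.le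
  have hadd := hpos.add hle
  rw [hcano.mpsGram_eq hΛ0 hk.le, ← conjTranspose_mpsGram (fun i s => Γ i s * Λ (i + 1))]
    at hadd
  set G := mpsGram (fun i s => Γ i s * Λ (i + 1))
    (fun i s => Γ i s * Λ (i + 1) * (if i + 1 < N then truncP χ' (χ (i + 1)) else 1)) k
  have hsum := posSemidef_sum (Finset.univ : Finset (Fin d)) fun s _ =>
    hadd.conjTranspose_mul_mul_same (Γ k s * Λ (k + 1))
  set H := ∑ s, (Γ k s * Λ (k + 1))ᴴ * G * (Γ k s * Λ (k + 1)) with hH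
  have hHc : Hᴴ = ∑ s, (Γ k s * Λ (k + 1))ᴴ * Gᴴ * (Γ k s * Λ (k + 1)) := by
    simp [hH, conjTranspose_sum, conjTranspose_mul, Matrix.mul_assoc]
  have heq : ∑ s, (Γ k s * Λ (k + 1))ᴴ * ((Λ k)ᴴ * Λ k + (Λ k)ᴴ * Λ k - G - Gᴴ) *
      (Γ k s * Λ (k + 1)) =
      (Λ (k + 1))ᴴ * Λ (k + 1) + (Λ (k + 1))ᴴ * Λ (k + 1) - H - Hᴴ := by
    rw [hHc]
    simp only [Matrix.mul_sub, Matrix.sub_mul, Matrix.mul_add, Matrix.add_mul,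
      Finset.sum_sub_distrib, Finset.sum_add_distrib, hcano.sum_conjTranspose_mul hk, hH]
  have hnn : 0 ≤ ((Λ (k + 1))ᴴ * Λ (k + 1) + (Λ (k + 1))ᴴ * Λ (k + 1) - H - Hᴴ) α α := by
    rw [← heq]
    convert hsum.diag_nonneg using 6
    abel
  have hre := (Complex.nonneg_iff.mp hnn).1
  simp only [Matrix.sub_apply, Matrix.add_apply, conjTranspose_apply, Complex.sub_re,
    Complex.add_re, Complex.star_def, Complex.conj_re] at hre
  linarith

theorem IsCanonicalMPS.re_trace_mpsGram_sub_le [NeZero d] (hcano : IsCanonicalMPS N χ Γ Λ)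
    (hΛ0 : Λ 0 = 1) (hΛdiag : ∀ i ≤ N, (Λ i).IsDiag)
    (hΛreal : ∀ i ≤ N, ∀ α, (Λ i α α).im = 0) (χ' : ℕ) {k : ℕ} (hk : k < N) :
    (mpsGram (fun i s => Γ i s * Λ (i + 1))
      (fun i s => Γ i s * Λ (i + 1) * (if i + 1 < N then truncP χ' (χ (i + 1)) else 1))
        k).trace.re -
    (mpsGram (fun i s => Γ i s * Λ (i + 1))
      (fun i s => Γ i s * Λ (i + 1) * (if i + 1 < N then truncP χ' (χ (i + 1)) else 1))
        (k + 1)).trace.re ≤ if k + 1 < N then locErr χ' χ Λ (k + 1) else 0 := by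
  have hH := hcano.re_sum_conjTranspose_mul_mpsGram_le hΛ0 hΛdiag χ' hk
  simp only [mpsGram]
  set G := mpsGram (fun i s => Γ i s * Λ (i + 1))
    (fun i s => Γ i s * Λ (i + 1) * (if i + 1 < N then truncP χ' (χ (i + 1)) else 1)) k
  rw [← hcano.trace_sum_conjTranspose_mul hk G]
  simp only [← Matrix.mul_assoc _ _ (if k + 1 < N then truncP χ' (χ (k + 1)) else 1),
    ← Matrix.sum_mul]
  set H := ∑ s, (Γ k s * Λ (k + 1))ᴴ * G * (Γ k s * Λ (k + 1))
  split_ifs with h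
  · simp only [Matrix.trace, Matrix.diag_apply, truncP, mul_diagonal, Complex.re_sum, locErr,
      ← Finset.sum_sub_distrib]
    refine Finset.sum_le_sum fun α _ => ?_
    by_cases hα : (α : ℕ) < χ'
    · simp [hα, Nat.not_le.mpr hα]
    · have hΛα : (((Λ (k + 1))ᴴ * Λ (k + 1)) α α).re = (Λ (k + 1) α α).re ^ 2 := by
        rw [Matrix.mul_apply, Finset.sum_eq_single α]
        · simp [hΛreal _ hk α, sq]
        · intro β _ hβ
          simp [hΛdiag _ hk hβ]
        · simp
      simpa [hα, not_lt.mp hα, hΛα] using hH α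
  · simp

theorem IsCanonicalMPS.one_sub_globErr_le_re_trace_mpsGram [NeZero d]
    (hcano : IsCanonicalMPS N χ Γ Λ) (hχ0 : χ 0 = 1)
    (hΛ0 : Λ 0 = 1) (hΛdiag : ∀ i ≤ N, (Λ i).IsDiag)
    (hΛreal : ∀ i ≤ N, ∀ α, (Λ i α α).im = 0) (χ' : ℕ) :
    1 - globErr N χ' χ Λ ≤ (mpsGram (fun i s => Γ i s * Λ (i + 1))
      (fun i s => Γ i s * Λ (i + 1) * (if i + 1 < N then truncP χ' (χ (i + 1)) else 1))
        N).trace.re := by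
  have hstep := Finset.sum_le_sum fun k hk => hcano.re_trace_mpsGram_sub_le hΛ0 hΛdiag hΛreal χ'
    (Finset.mem_range.mp hk)
  rw [Finset.sum_range_sub'] at hstep
  have hglob : ∑ k ∈ Finset.range N, (if k + 1 < N then locErr χ' χ Λ (k + 1) else 0) =
      globErr N χ' χ Λ := by
    rw [globErr, Finset.sum_Ico_eq_sum_range, ← Finset.sum_filter]
    refine Finset.sum_congr ?_ fun k _ => by rw [add_comm]
    ext k
    simp only [Finset.mem_filter, Finset.mem_range]
    omega
  rw [hglob] at hstep
  simp only [mpsGram, Matrix.trace_one, Fintype.card_fin, hχ0, Nat.cast_one,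
    Complex.one_re] at hstep
  linarith

theorem IsCanonicalMPS.re_trace_mpsGram_le_one (hcano : IsCanonicalMPS N χ Γ Λ)
    (hχN : χ N = 1) (hΛ0 : Λ 0 = 1) (hΛN : Λ N = 1) (hΛdiag : ∀ i ≤ N, (Λ i).IsDiag)
    (χ' : ℕ) :
    (mpsGram
      (fun i s => Γ i s * Λ (i + 1) * (if i + 1 < N then truncP χ' (χ (i + 1)) else 1))
      (fun i s => Γ i s * Λ (i + 1) * (if i + 1 < N then truncP χ' (χ (i + 1)) else 1))
      N).trace.re ≤ 1 := by
  have h := (Complex.nonneg_iff.mp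
    (hcano.posSemidef_sub_mpsGram hΛ0 hΛdiag χ' le_rfl).trace_nonneg).1
  simp only [hΛN, conjTranspose_one, Matrix.mul_one, trace_sub, trace_one, Fintype.card_fin,
    hχN, Nat.cast_one, Complex.sub_re, Complex.one_re] at h
  linarith

end Truncation

/-- Lemma 2 of the paper: for an `N`-site MPS in canonical form with
normalized wavefunction and any truncation rank `χ' ≥ 1`, the norm
`n = ‖Ψ̃_T‖ = (∑_σ |Ψ̃_T(σ)|²)^{1/2}` of the wavefunction after the parallel MPS compression
is bounded as `1 − √(2 ε(χ')) ≤ n ≤ 1`. -/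
theorem parallel_mps_compression_norm_bounds
    (N d : ℕ) [NeZero d] (hN : 1 ≤ N)
    (χ : ℕ → ℕ) (hχ0 : χ 0 = 1) (hχN : χ N = 1) (hχpos : ∀ i, 1 ≤ χ i)
    (Γ : (i : ℕ) → Fin d → Matrix (Fin (χ i)) (Fin (χ (i + 1))) ℂ)
    (Λ : (i : ℕ) → Matrix (Fin (χ i)) (Fin (χ i)) ℂ)
    (hΛ0 : Λ 0 = 1) (hΛN : Λ N = 1)
    (hΛdiag : ∀ i ≤ N, (Λ i).IsDiag)
    (hΛreal : ∀ i ≤ N, ∀ α, (Λ i α α).im = 0 ∧ 0 ≤ (Λ i α α).re)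
    (hΛdesc : ∀ i ≤ N, ∀ α β : Fin (χ i), α ≤ β → (Λ i β β).re ≤ (Λ i α α).re)
    (hcano : IsCanonicalMPS N χ Γ Λ)
    (hnorm : ∑ σ : Fin N → Fin d, ‖mpsPsi N χ Γ Λ σ‖ ^ 2 = 1)
    (χ' : ℕ) (hχ' : 1 ≤ χ') :
    1 - Real.sqrt (2 * globErr N χ' χ Λ) ≤
        Real.sqrt (∑ σ : Fin N → Fin d, ‖mpsPsiT N χ' χ Γ Λ σ‖ ^ 2) ∧
      Real.sqrt (∑ σ : Fin N → Fin d, ‖mpsPsiT N χ' χ Γ Λ σ‖ ^ 2) ≤ 1 := by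
  set M : (i : ℕ) → Fin d → Matrix (Fin (χ i)) (Fin (χ (i + 1))) ℂ :=
    fun i s => Γ i s * Λ (i + 1) with hM
  set M' : (i : ℕ) → Fin d → Matrix (Fin (χ i)) (Fin (χ (i + 1))) ℂ :=
    fun i s => Γ i s * Λ (i + 1) * (if i + 1 < N then truncP χ' (χ (i + 1)) else 1) with hM'
  have hover : ∑ σ, star (mpsPsi N χ Γ Λ σ) * mpsPsiT N χ' χ Γ Λ σ =
      (mpsGram M M' N).trace := by
    rw [← sum_star_mul_eq_trace_mpsGram M M' hχ0 hχN]
    simp only [mpsPsi, mpsPsiT, mpsW_eq_mpsChain hΛ0, mpsWT_eq_mpsChain hΛ0, hM, hM']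
  have hnormT : ∑ σ, ‖mpsPsiT N χ' χ Γ Λ σ‖ ^ 2 = (mpsGram M' M' N).trace.re := by
    rw [← sum_star_mul_eq_trace_mpsGram M' M' hχ0 hχN, Complex.re_sum]
    refine Finset.sum_congr rfl fun σ _ => ?_
    simp only [mpsPsiT, mpsWT_eq_mpsChain hΛ0, Complex.star_def, Complex.conj_mul']
    norm_cast
  have hle : ∑ σ, ‖mpsPsiT N χ' χ Γ Λ σ‖ ^ 2 ≤ 1 := by
    rw [hnormT]
    exact hcano.re_trace_mpsGram_le_one hχN hΛ0 hΛN hΛdiag χ'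
  refine ⟨?_, Real.sqrt_le_one.mpr hle⟩
  have hlow : 1 - globErr N χ' χ Λ ≤ (mpsGram M M' N).trace.re :=
    hcano.one_sub_globErr_le_re_trace_mpsGram hχ0 hΛ0 hΛdiag (fun i hi α => (hΛreal i hi α).1) χ'
  have hCS : (mpsGram M M' N).trace.re ≤ √(∑ σ, ‖mpsPsiT N χ' χ Γ Λ σ‖ ^ 2) := by
    calc (mpsGram M M' N).trace.re
        ≤ ∑ σ, ‖mpsPsi N χ Γ Λ σ‖ * ‖mpsPsiT N χ' χ Γ Λ σ‖ := by
          rw [← hover, Complex.re_sum]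
          refine Finset.sum_le_sum fun σ _ => (Complex.re_le_norm _).trans_eq ?_
          rw [norm_mul, norm_star]
      _ ≤ √(∑ σ, ‖mpsPsi N χ Γ Λ σ‖ ^ 2) * √(∑ σ, ‖mpsPsiT N χ' χ Γ Λ σ‖ ^ 2) :=
          Real.sum_mul_le_sqrt_mul_sqrt _ _ _
      _ = _ := by rw [hnorm, Real.sqrt_one, one_mul]
  have hsqrt : min (globErr N χ' χ Λ) 1 ≤ √(2 * globErr N χ' χ Λ) := by
    refine Real.le_sqrt_of_sq_le ?_
    have hε : 0 ≤ globErr N χ' χ Λ :=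
      Finset.sum_nonneg fun i _ => Finset.sum_nonneg fun α _ => by positivity
    rcases min_cases (globErr N χ' χ Λ) 1 with h | h <;> rw [h.1] <;> nlinarith
  have hnonneg := Real.sqrt_nonneg (∑ σ, ‖mpsPsiT N χ' χ Γ Λ σ‖ ^ 2)
  rcases min_le_iff.mp hsqrt with h | h <;> linarith
end
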